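/- Let R₀ > 1 be a real number. Then the final-size equation r = 1 − exp(−R₀ · r) has exactly one solution r∞ in the open interval (0, 1). -/

import Mathlib

lemma final_size_aux (R r s : ℝ) (hR : 1 < R) (hr : 0 < r) (hrs : r < s)
    (h1 : r = 1 - Real.exp (-R * r)) (h2 : s = 1 - Real.exp (-R * s)) : False := by
  have hs : 0 < s := hr.trans hrs
  have hne : (0 : ℝ) ≠ -R * s := by nlinarith [mul_pos (by linarith : 0 < R) hs]
  have ha : 0 < 1 - r / s := by
    have := (div_lt_one hs).2 hrs
    linarith
  have hb : 0 < r / s := div_pos hr hs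
  have h := strictConvexOn_exp.2 (Set.mem_univ 0) (Set.mem_univ (-R * s)) hne ha hb (by ring)
  simp only [smul_eq_mul, Real.exp_zero, mul_zero, zero_add, mul_one] at h
  have e : r / s * (-R * s) = -R * r := by field_simp
  have e2 : Real.exp (-R * s) = 1 - s := by linarith
  have e3 : r / s * s = r := by field_simp
  rw [e, e2] at h
  nlinarith

/-- For `R₀ > 1`, the final-size equation `r = 1 - exp (-R₀ · r)`
has exactly one solution in the open interval `(0, 1)`. -/
theorem statement_11 (R₀ : ℝ) (hR₀ : 1 < R₀) :
    ∃! r : ℝ, r ∈ Set.Ioo (0 : ℝ) 1 ∧ r = 1 - Real.exp (-R₀ * r) := by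
  have hR : 0 < R₀ := by linarith
  have ha0 : 0 < (R₀ - 1) / R₀ := div_pos (by linarith) hR
  have ha1 : (R₀ - 1) / R₀ ≤ 1 := (div_le_one hR).2 (by linarith)
  have hcont : ContinuousOn (fun r : ℝ => 1 - Real.exp (-R₀ * r) - r)
      (Set.Icc ((R₀ - 1) / R₀) 1) := by fun_prop
  have hga : 0 ≤ 1 - Real.exp (-R₀ * ((R₀ - 1) / R₀)) - (R₀ - 1) / R₀ := by
    have e : -R₀ * ((R₀ - 1) / R₀) = -(R₀ - 1) := by field_simp
    have e2 : (R₀ - 1) / R₀ = 1 - R₀⁻¹ := by field_simp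
    rw [e, e2, Real.exp_neg]
    have : (Real.exp (R₀ - 1))⁻¹ ≤ R₀⁻¹ :=
      inv_anti₀ hR (by linarith [Real.add_one_le_exp (R₀ - 1)])
    linarith
  have hg1 : 1 - Real.exp (-R₀ * 1) - 1 ≤ 0 := by linarith [Real.exp_pos (-R₀ * 1)]
  obtain ⟨r, ⟨hra, hr1⟩, hr⟩ := intermediate_value_Icc' ha1 hcont ⟨hg1, hga⟩
  have hr' : 1 - Real.exp (-R₀ * r) - r = 0 := hr
  have hr0 : 0 < r := ha0.trans_le hra
  have hreq : r = 1 - Real.exp (-R₀ * r) := by linarith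
  refine ⟨r, ⟨⟨hr0, by linarith [Real.exp_pos (-R₀ * r)]⟩, hreq⟩, ?_⟩
  rintro y ⟨⟨hy0, hy1⟩, hy⟩
  rcases lt_trichotomy y r with h | h | h
  · exact (final_size_aux R₀ y r hR₀ hy0 h hy hreq).elim
  · exact h
  · exact (final_size_aux R₀ r y hR₀ hr0 h hreq hy).elim
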